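/- Let G be a graph with maximum degree Δ ≥ 2 and maximum average degree less than 14/5. Then G has a semistrong edge coloring with at most 2Δ + 4 colors, i.e., χ'_ss(G) ≤ 2Δ + 4. -/

import Mathlib

namespace SSE

open SimpleGraph

variable {V : Type*} {W : Type*}

/-- The set of vertices covered by a set of edges. -/
def cov (M : Set (Sym2 V)) : Set V := {v | ∃ e ∈ M, v ∈ e}

/-- `M` is a matching of `G`: a set of pairwise disjoint edges of `G`. -/
def IsMatchingSet (G : SimpleGraph V) (M : Set (Sym2 V)) : Prop :=
  M ⊆ G.edgeSet ∧ ∀ e ∈ M, ∀ f ∈ M, e ≠ f → ∀ v : V, v ∈ e → v ∉ f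

/-- `v` is a pendant vertex (degree 1) of the subgraph `G_M` of `G` induced by
the vertices covered by `M`. -/
def PendantIn (G : SimpleGraph V) (M : Set (Sym2 V)) (v : V) : Prop :=
  v ∈ cov M ∧ ∃! u, u ∈ cov M ∧ G.Adj v u

/-- `M` is an induced (strong) matching of `G`: every vertex of `G_M` is pendant in `G_M`. -/
def IsInducedMatching (G : SimpleGraph V) (M : Set (Sym2 V)) : Prop :=
  IsMatchingSet G M ∧ ∀ v ∈ cov M, PendantIn G M v

/-- `M` is a semistrong matching of `G`: every edge of `M` is a pendant edge of `G_M`. -/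
def IsSemistrongMatching (G : SimpleGraph V) (M : Set (Sym2 V)) : Prop :=
  IsMatchingSet G M ∧ ∀ e ∈ M, ∃ v, v ∈ e ∧ PendantIn G M v

/-- `N` is a perfect matching of the subgraph of `G` induced by `S`. -/
def IsPerfectMatchingOn (G : SimpleGraph V) (S : Set V) (N : Set (Sym2 V)) : Prop :=
  IsMatchingSet G N ∧ (∀ e ∈ N, ∀ v : V, v ∈ e → v ∈ S) ∧ cov N = S

/-- `M` is a uniquely restricted matching of `G`: it is the unique perfect matching
of the subgraph induced by the vertices it covers. -/
def IsUniquelyRestrictedMatching (G : SimpleGraph V) (M : Set (Sym2 V)) : Prop :=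
  IsMatchingSet G M ∧ ∀ N : Set (Sym2 V), IsPerfectMatchingOn G (cov M) N → N = M

/-- An edge coloring of `G` with colors `< k` each of whose color classes satisfies `P`. -/
def IsPColoring (G : SimpleGraph V) (P : SimpleGraph V → Set (Sym2 V) → Prop)
    (c : Sym2 V → ℕ) (k : ℕ) : Prop :=
  (∀ e ∈ G.edgeSet, c e < k) ∧ ∀ i : ℕ, P G {e | e ∈ G.edgeSet ∧ c e = i}

/-- The least number of colors in an edge coloring of `G` whose color classes satisfy `P`. -/
noncomputable def pIndex (G : SimpleGraph V)
    (P : SimpleGraph V → Set (Sym2 V) → Prop) : ℕ :=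
  sInf {k | ∃ c, IsPColoring G P c k}

/-- The chromatic index. -/
noncomputable def chromIndex (G : SimpleGraph V) : ℕ := pIndex G IsMatchingSet

/-- The uniquely restricted chromatic index. -/
noncomputable def urIndex (G : SimpleGraph V) : ℕ := pIndex G IsUniquelyRestrictedMatching

/-- The semistrong chromatic index. -/
noncomputable def ssIndex (G : SimpleGraph V) : ℕ := pIndex G IsSemistrongMatching

/-- The strong chromatic index. -/
noncomputable def strongIndex (G : SimpleGraph V) : ℕ := pIndex G IsInducedMatching

/-- The degree of a vertex. -/
noncomputable def natDeg (G : SimpleGraph V) (v : V) : ℕ := (G.neighborSet v).ncard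

/-- The maximum average degree of `G` is (strictly) less than `q`:
every nonempty (induced) subgraph has average degree `< q`. -/
def MadLT (G : SimpleGraph V) (q : ℚ) : Prop :=
  ∀ s : Set V, s.Finite → s.Nonempty →
    (2 * ({e ∈ G.edgeSet | ∀ v ∈ e, v ∈ s}.ncard : ℚ)) < q * s.ncard

/-- `K` is a minor of `G` (branch-set formulation). -/
def HasMinor (G : SimpleGraph V) (K : SimpleGraph W) : Prop :=
  ∃ B : W → Set V, (∀ w, (B w).Nonempty) ∧
    (∀ w, (G.induce (B w)).Connected) ∧
    (Pairwise fun w w' => Disjoint (B w) (B w')) ∧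
    (∀ w w', K.Adj w w' → ∃ u ∈ B w, ∃ v ∈ B w', G.Adj u v)

/-- `G` is planar (by Wagner's theorem: no `K₅` minor and no `K₃,₃` minor). -/
def IsPlanar (G : SimpleGraph V) : Prop :=
  ¬ HasMinor G (completeGraph (Fin 5)) ∧
  ¬ HasMinor G (completeBipartiteGraph (Fin 3) (Fin 3))

/-- The join `C_Δ ∨ I_2` of a cycle on `Δ` vertices with an independent set of 2 vertices. -/
def joinCI (n : ℕ) : SimpleGraph (Fin n ⊕ Fin 2) :=
  SimpleGraph.fromRel (fun x y =>
    match x, y with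
    | Sum.inl a, Sum.inl b => (SimpleGraph.cycleGraph n).Adj a b
    | Sum.inl _, Sum.inr _ => True
    | _, _ => False)

/-- `G` contains an `M`-alternating cycle: a cycle whose edges alternate between
edges in `M` and edges not in `M` (cyclically). -/
def HasAlternatingCycle (G : SimpleGraph V) (M : Set (Sym2 V)) : Prop :=
  ∃ (v : V) (c : G.Walk v v), c.IsCycle ∧
    List.Chain' (fun e f => ¬(e ∈ M ↔ f ∈ M)) c.edges ∧
    ∀ e ∈ c.edges.head?, ∀ f ∈ c.edges.getLast?, ¬(e ∈ M ↔ f ∈ M)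

/-- Edges `e` and `f` lie together on a cycle of length 4 in `G`. -/
def OnCommonC4 (G : SimpleGraph V) (e f : Sym2 V) : Prop :=
  ∃ (v : V) (c : G.Walk v v), c.IsCycle ∧ c.length = 4 ∧ e ∈ c.edges ∧ f ∈ c.edges


section Helpers

open Classical

variable {V : Type*}

/-- Neighbours of `v` inside `S`. -/
noncomputable def nb (G : SimpleGraph V) (S : Finset V) (v : V) : Finset V :=
  S.filter (fun w => G.Adj v w)

lemma mem_nb {G : SimpleGraph V} {S : Finset V} {v w : V} :
    w ∈ nb G S v ↔ w ∈ S ∧ G.Adj v w := by simp [nb]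

/-- A coloring `c` of the edges of `G[S]` with colors `< K`, with pendant relation `D`
(`D v u` means that `v` is the designated pendant end of the edge `vu`). -/
structure Good (G : SimpleGraph V) (K : ℕ) (S : Finset V) (c : Sym2 V → ℕ)
    (D : V → V → Prop) : Prop where
  lt : ∀ u ∈ S, ∀ v ∈ S, G.Adj u v → c s(u, v) < K
  proper : ∀ u ∈ S, ∀ v ∈ S, ∀ w ∈ S, G.Adj u v → G.Adj u w → v ≠ w → c s(u, v) ≠ c s(u, w)
  pend : ∀ v ∈ S, ∀ u ∈ S, G.Adj v u → D v u → ∀ y ∈ S, G.Adj v y → y ≠ u →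
    ∀ z ∈ S, G.Adj y z → c s(y, z) ≠ c s(v, u)
  tot : ∀ u ∈ S, ∀ v ∈ S, G.Adj u v → D u v ∨ D v u
  out : ∀ v ∈ S, ((nb G S v).filter (D v)).card ≤ 2

lemma ext_good {G : SimpleGraph V} {K : ℕ} {S : Finset V} {c : Sym2 V → ℕ}
    {D : V → V → Prop} (h : Good G K S c D) {v : V} (hv : v ∉ S) (g : V → ℕ)
    (hT : (nb G S v).card ≤ 2)
    (hlt : ∀ t ∈ nb G S v, g t < K)
    (hinj : ∀ t ∈ nb G S v, ∀ t' ∈ nb G S v, t ≠ t' → g t ≠ g t')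
    (h1 : ∀ t ∈ nb G S v, ∀ t' ∈ nb G S v, ∀ y ∈ S, G.Adj t' y → g t ≠ c s(t', y))
    (h2 : ∀ t ∈ nb G S v, ∀ y ∈ S, G.Adj t y → ∀ z ∈ S, G.Adj y z → D y z →
      g t ≠ c s(y, z)) :
    ∃ c' D', Good G K (insert v S) c' D' := by
  have hne : ∀ {x}, x ∈ S → x ≠ v := fun hx e => hv (e ▸ hx)
  obtain ⟨c', hc1, hc2⟩ : ∃ c' : Sym2 V → ℕ, (∀ t, c' s(v, t) = g t) ∧
      ∀ a ∈ S, ∀ b ∈ S, c' s(a, b) = c s(a, b) := by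
    refine ⟨fun e => if hh : v ∈ e then g (Sym2.Mem.other hh) else c e, ?_, ?_⟩
    · intro t
      have hm : v ∈ s(v, t) := Sym2.mem_mk_left v t
      have := Sym2.other_spec hm
      have h3 : Sym2.Mem.other hm = t := by
        exact Sym2.congr_right.1 this
      simp only [hm, dite_true, h3]
    · intro a ha b hb
      have : ¬ v ∈ s(a, b) := by
        rw [Sym2.mem_iff]; rintro (e | e)
        · exact hne ha e.symm
        · exact hne hb e.symm
      simp only [this, dite_false]
  have hc3 : ∀ t, c' s(t, v) = g t := fun t => by rw [Sym2.eq_swap]; exact hc1 t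
  have nbv : ∀ {t}, t ∈ S → G.Adj v t → t ∈ nb G S v := fun a b => mem_nb.2 ⟨a, b⟩
  refine ⟨c', fun a b => a = v ∨ (D a b ∧ b ≠ v), ?_, ?_, ?_, ?_, ?_⟩
  · intro a ha b hb hab
    rcases Finset.mem_insert.1 ha with rfl | ha' <;> rcases Finset.mem_insert.1 hb with rfl | hb'
    · exact absurd hab (G.irrefl)
    · rw [hc1]; exact hlt _ (nbv hb' hab)
    · rw [hc3]; exact hlt _ (nbv ha' hab.symm)
    · rw [hc2 _ ha' _ hb']; exact h.lt _ ha' _ hb' hab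
  · intro a ha b hb w hw hab haw hbw
    rcases Finset.mem_insert.1 ha with rfl | ha'
    · rcases Finset.mem_insert.1 hb with rfl | hb'
      · exact absurd hab (G.irrefl)
      rcases Finset.mem_insert.1 hw with rfl | hw'
      · exact absurd haw (G.irrefl)
      rw [hc1, hc1]; exact hinj _ (nbv hb' hab) _ (nbv hw' haw) hbw
    · rcases Finset.mem_insert.1 hb with rfl | hb'
      · rcases Finset.mem_insert.1 hw with rfl | hw'
        · exact absurd rfl hbw
        rw [hc3, hc2 _ ha' _ hw']
        exact h1 _ (nbv ha' hab.symm) _ (nbv ha' hab.symm) _ hw' haw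
      · rcases Finset.mem_insert.1 hw with rfl | hw'
        · rw [hc3, hc2 _ ha' _ hb']
          exact (h1 _ (nbv ha' haw.symm) _ (nbv ha' haw.symm) _ hb' hab).symm
        rw [hc2 _ ha' _ hb', hc2 _ ha' _ hw']
        exact h.proper _ ha' _ hb' _ hw' hab haw hbw
  · intro a ha b hb hab hD y hy hay hyb z hz hyz
    rcases Finset.mem_insert.1 ha with rfl | ha'
    · rcases Finset.mem_insert.1 hb with rfl | hb'
      · exact absurd hab (G.irrefl)
      rcases Finset.mem_insert.1 hy with rfl | hy'
      · exact absurd hay (G.irrefl)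
      rcases Finset.mem_insert.1 hz with rfl | hz'
      · rw [hc3, hc1]; exact hinj _ (nbv hy' hay) _ (nbv hb' hab) hyb
      · rw [hc2 _ hy' _ hz', hc1]
        exact (h1 _ (nbv hb' hab) _ (nbv hy' hay) _ hz' hyz).symm
    · rcases hD with e | ⟨hD, hbv⟩
      · exact absurd e (hne ha')
      have hb' : b ∈ S := (Finset.mem_insert.1 hb).resolve_left hbv
      rw [hc2 _ ha' _ hb']
      rcases Finset.mem_insert.1 hy with rfl | hy'
      · rcases Finset.mem_insert.1 hz with rfl | hz'
        · exact absurd hyz (G.irrefl)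
        rw [hc1]
        exact h1 _ (nbv hz' hyz) _ (nbv ha' hay.symm) _ hb' hab
      · rcases Finset.mem_insert.1 hz with rfl | hz'
        · rw [hc3]
          exact h2 _ (nbv hy' hyz.symm) _ ha' hay.symm _ hb' hab hD
        · rw [hc2 _ hy' _ hz']
          exact h.pend _ ha' _ hb' hab hD _ hy' hay hyb _ hz' hyz
  · intro a ha b hb hab
    rcases Finset.mem_insert.1 ha with rfl | ha'
    · exact Or.inl (Or.inl rfl)
    rcases Finset.mem_insert.1 hb with rfl | hb'
    · exact Or.inr (Or.inl rfl)
    rcases h.tot _ ha' _ hb' hab with hD | hD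
    · exact Or.inl (Or.inr ⟨hD, hne hb'⟩)
    · exact Or.inr (Or.inr ⟨hD, hne ha'⟩)
  · intro a ha
    rcases Finset.mem_insert.1 ha with rfl | ha'
    · refine le_trans (Finset.card_le_card ?_) hT
      intro w hw
      replace hw := (@Finset.mem_filter _ _ (_) _ _).1 hw
      rw [mem_nb, Finset.mem_insert] at hw
      obtain ⟨⟨rfl | hw, hadj⟩, -⟩ := hw
      · exact absurd hadj (G.irrefl)
      · exact nbv hw hadj
    · refine le_trans (Finset.card_le_card ?_) (h.out a ha')
      intro w hw
      replace hw := (@Finset.mem_filter _ _ (_) _ _).1 hw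
      rw [mem_nb, Finset.mem_insert] at hw
      obtain ⟨⟨hw, hadj⟩, e | ⟨hD, hwv⟩⟩ := hw
      · exact absurd e (hne ha')
      · rw [Finset.mem_filter, mem_nb]
        exact ⟨⟨hw.resolve_left hwv, hadj⟩, hD⟩

/-- Colors at `u`. -/
noncomputable def eCol (G : SimpleGraph V) (S : Finset V) (c : Sym2 V → ℕ) (u : V) : Finset ℕ :=
  (nb G S u).image (fun y => c s(u, y))

/-- Colors at `u` and colors of edges whose pendant end is a neighbour of `u`. -/
noncomputable def pCol (G : SimpleGraph V) (S : Finset V) (c : Sym2 V → ℕ)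
    (D : V → V → Prop) (u : V) : Finset ℕ :=
  eCol G S c u ∪ (nb G S u).biUnion
    (fun y => (((nb G S y).filter (D y)).erase u).image (fun z => c s(y, z)))

lemma eCol_card (G : SimpleGraph V) (S : Finset V) (c : Sym2 V → ℕ) (u : V) :
    (eCol G S c u).card ≤ (nb G S u).card := Finset.card_image_le

lemma mem_eCol {G : SimpleGraph V} {S : Finset V} {c : Sym2 V → ℕ} {u y : V}
    (hy : y ∈ S) (h : G.Adj u y) : c s(u, y) ∈ eCol G S c u :=
  Finset.mem_image.2 ⟨y, mem_nb.2 ⟨hy, h⟩, rfl⟩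

lemma mem_pCol {G : SimpleGraph V} {S : Finset V} {c : Sym2 V → ℕ} {D : V → V → Prop}
    {u y z : V} (hy : y ∈ S) (h : G.Adj u y) (hz : z ∈ S) (hyz : G.Adj y z) (hD : D y z) :
    c s(y, z) ∈ pCol G S c D u := by
  by_cases e : z = u
  · subst e
    rw [Sym2.eq_swap]
    exact Finset.mem_union_left _ (mem_eCol hy h)
  · refine Finset.mem_union_right _ (Finset.mem_biUnion.2 ⟨y, mem_nb.2 ⟨hy, h⟩, ?_⟩)
    refine Finset.mem_image.2 ⟨z, ?_, rfl⟩
    rw [Finset.mem_erase, Finset.mem_filter, mem_nb]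
    exact ⟨e, ⟨hz, hyz⟩, hD⟩

lemma pCol_card {G : SimpleGraph V} {K : ℕ} {S : Finset V} {c : Sym2 V → ℕ}
    {D : V → V → Prop} (h : Good G K S c D) {u : V} (hu : u ∈ S) :
    (pCol G S c D u).card ≤ 2 * (nb G S u).card + 2 := by
  have h1 : ((nb G S u).biUnion
    (fun y => (((nb G S y).filter (D y)).erase u).image (fun z => c s(y, z)))).card
      ≤ (nb G S u).card + 2 := by
    refine le_trans Finset.card_biUnion_le ?_
    have h2 : ∀ y ∈ nb G S u, ((((nb G S y).filter (D y)).erase u).image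
        (fun z => c s(y, z))).card ≤ 1 + if D u y then 1 else 0 := by
      intro y hy
      rw [mem_nb] at hy
      refine le_trans Finset.card_image_le ?_
      have ho := h.out y hy.1
      split_ifs with hD
      · exact le_trans (Finset.card_le_card (Finset.erase_subset _ _)) ho
      · have hD' := (h.tot u hu y hy.1 hy.2).resolve_left hD
        rw [Finset.card_erase_of_mem]
        · omega
        · rw [Finset.mem_filter, mem_nb]; exact ⟨⟨hu, hy.2.symm⟩, hD'⟩
    refine le_trans (Finset.sum_le_sum h2) ?_
    rw [Finset.sum_add_distrib, ← Finset.card_filter]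
    have h5 := h.out u hu
    simp only [Finset.sum_const, smul_eq_mul, mul_one]
    refine Nat.add_le_add_left ?_ _
    convert h5
  have h3 := eCol_card G S c u
  have := Finset.card_union_le (eCol G S c u) ((nb G S u).biUnion
    (fun y => (((nb G S y).filter (D y)).erase u).image (fun z => c s(y, z))))
  unfold pCol
  omega

lemma pCol_card' {G : SimpleGraph V} {S : Finset V} {c : Sym2 V → ℕ}
    {D : V → V → Prop} {u : V} (hu : u ∈ S)
    (h2 : ∀ y ∈ nb G S u, (nb G S y).card ≤ 2) :
    (pCol G S c D u).card ≤ 2 * (nb G S u).card := by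
  have h1 : ((nb G S u).biUnion
    (fun y => (((nb G S y).filter (D y)).erase u).image (fun z => c s(y, z)))).card
      ≤ (nb G S u).card * 1 := by
    refine Finset.card_biUnion_le_card_mul _ _ _ ?_
    intro y hy
    refine le_trans Finset.card_image_le ?_
    have h4 := h2 y hy
    rw [mem_nb] at hy
    have h5 : ((nb G S y).erase u).card = (nb G S y).card - 1 :=
      Finset.card_erase_of_mem (mem_nb.2 ⟨hu, hy.2.symm⟩)
    have h6 := Finset.card_le_card
      (Finset.erase_subset_erase u (Finset.filter_subset (D y) (nb G S y)))
    omega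
  have h3 := eCol_card G S c u
  have := Finset.card_union_le (eCol G S c u) ((nb G S u).biUnion
    (fun y => (((nb G S y).filter (D y)).erase u).image (fun z => c s(y, z))))
  unfold pCol
  omega

lemma exists_color (F : Finset ℕ) (K : ℕ) (h : F.card < K) : ∃ a < K, a ∉ F := by
  by_contra! hc
  have : Finset.range K ⊆ F := fun a ha => hc a (Finset.mem_range.1 ha)
  have := Finset.card_le_card this
  rw [Finset.card_range] at this
  omega

lemma nb_insert_self {G : SimpleGraph V} {S : Finset V} {v : V} :
    nb G (insert v S) v = nb G S v := by
  ext w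
  simp only [mem_nb, Finset.mem_insert]
  constructor
  · rintro ⟨rfl | h, h'⟩
    · exact absurd h' (G.irrefl)
    · exact ⟨h, h'⟩
  · rintro ⟨h, h'⟩; exact ⟨Or.inr h, h'⟩

lemma nb_insert_card {G : SimpleGraph V} {S : Finset V} {v u : V} (hv : v ∉ S)
    (h : G.Adj v u) : (nb G (insert v S) u).card = (nb G S u).card + 1 := by
  have : nb G (insert v S) u = insert v (nb G S u) := by
    ext w
    simp only [mem_nb, Finset.mem_insert]
    constructor
    · rintro ⟨rfl | h, h'⟩
      · exact Or.inl rfl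
      · exact Or.inr ⟨h, h'⟩
    · rintro (rfl | ⟨h1, h'⟩)
      · exact ⟨Or.inl rfl, h.symm⟩
      · exact ⟨Or.inr h1, h'⟩
  rw [this, Finset.card_insert_of_notMem]
  simp [mem_nb, hv]

lemma nb_mono {G : SimpleGraph V} {S T : Finset V} (h : S ⊆ T) (v : V) :
    (nb G S v).card ≤ (nb G T v).card :=
  Finset.card_le_card (Finset.filter_subset_filter _ h)

/-- Reinserting a vertex of degree at most one. -/
lemma step_leaf {G : SimpleGraph V} {Δ : ℕ} {S : Finset V} {c : Sym2 V → ℕ}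
    {D : V → V → Prop} (h : Good G (2 * Δ + 4) S c D) {v : V} (hv : v ∉ S)
    (hub : ∀ w, (nb G (insert v S) w).card ≤ Δ)
    (hd : (nb G S v).card ≤ 1) :
    ∃ c' D', Good G (2 * Δ + 4) (insert v S) c' D' := by
  rcases Finset.eq_empty_or_nonempty (nb G S v) with h0 | ⟨u, hu⟩
  · apply ext_good h hv (fun _ => 0) <;> simp [h0]
  · have huniq : ∀ t ∈ nb G S v, t = u := fun t ht => Finset.card_le_one.1 hd t ht u hu
    have hu' := mem_nb.1 hu
    have hp := pCol_card h hu'.1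
    have hc := nb_insert_card hv hu'.2
    have hbu := hub u
    obtain ⟨a, haK, haF⟩ := exists_color (pCol G S c D u) (2 * Δ + 4) (by omega)
    apply ext_good h hv (fun _ => a)
    · omega
    · intro _ _; exact haK
    · intro t ht t' ht' hne
      exact absurd ((huniq t ht).trans (huniq t' ht').symm) hne
    · intro t _ t' ht' y hy hadj e
      rw [huniq t' ht'] at hadj e
      exact haF (e ▸ Finset.mem_union_left _ (mem_eCol hy hadj))
    · intro t ht y hy hadj z hz hyz hD e
      rw [huniq t ht] at hadj
      exact haF (e ▸ mem_pCol hy hadj hz hyz hD)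

/-- Reinserting a vertex of degree two with a suitable neighbour `x`. -/
lemma step_two {G : SimpleGraph V} {Δ : ℕ} (hΔ : 2 ≤ Δ) {S : Finset V} {c : Sym2 V → ℕ}
    {D : V → V → Prop} (h : Good G (2 * Δ + 4) S c D) {v : V} (hv : v ∉ S)
    (hub : ∀ w, (nb G (insert v S) w).card ≤ Δ)
    (hd : (nb G S v).card = 2) {x : V} (hx : x ∈ nb G S v)
    (hcfg : (nb G (insert v S) x).card ≤ 3 ∨ ((nb G (insert v S) x).card = 4 ∧
      ∀ y ∈ nb G (insert v S) x, (nb G (insert v S) y).card ≤ 2)) :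
    ∃ c' D', Good G (2 * Δ + 4) (insert v S) c' D' := by
  obtain ⟨u, hu, hux⟩ := Finset.exists_mem_ne (by omega : 1 < (nb G S v).card) x
  have huniq : ∀ t ∈ nb G S v, t = u ∨ t = x := by
    have : ({u, x} : Finset V) = nb G S v := by
      apply Finset.eq_of_subset_of_card_le
      · intro t ht
        rcases Finset.mem_insert.1 ht with rfl | ht
        · exact hu
        · rw [Finset.mem_singleton.1 ht]; exact hx
      · rw [Finset.card_pair hux, hd]
    intro t ht
    rw [← this] at ht
    simpa using ht
  have hu' := mem_nb.1 hu
  have hx' := mem_nb.1 hx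
  have hpu := pCol_card h hu'.1
  have hpx := pCol_card h hx'.1
  have hcu := nb_insert_card hv hu'.2
  have hcx := nb_insert_card hv hx'.2
  have hbu := hub u
  have hbx := hub x
  have heu := eCol_card G S c u
  have hex := eCol_card G S c x
  obtain ⟨a, haK, haF⟩ := exists_color (pCol G S c D u ∪ eCol G S c x) (2 * Δ + 4) (by
    have := Finset.card_union_le (pCol G S c D u) (eCol G S c x)
    omega)
  obtain ⟨b, hbK, hbF⟩ := exists_color (insert a (pCol G S c D x ∪ eCol G S c u)) (2 * Δ + 4) (by
    have h1 := Finset.card_union_le (pCol G S c D x) (eCol G S c u)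
    have h2 := Finset.card_insert_le a (pCol G S c D x ∪ eCol G S c u)
    rcases hcfg with h3 | ⟨h3, h4⟩
    · omega
    · have := pCol_card' (c := c) (D := D) hx'.1 (fun y hy =>
        le_trans (nb_mono (Finset.subset_insert v S) y)
          (h4 y (mem_nb.2 ⟨Finset.mem_insert_of_mem (mem_nb.1 hy).1, (mem_nb.1 hy).2⟩)))
      omega)
  rw [Finset.mem_union, not_or] at haF
  rw [Finset.mem_insert, not_or, Finset.mem_union, not_or] at hbF
  have pe : ∀ {w : V} {i : ℕ}, i ∉ pCol G S c D w → i ∉ eCol G S c w :=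
    fun hh hi => hh (Finset.mem_union_left _ hi)
  have gu : (fun t => if t = u then a else b) u = a := by simp
  have gx : (fun t => if t = u then a else b) x = b := by simp [hux.symm]
  generalize (fun t => if t = u then a else b) = g at gu gx
  apply ext_good h hv g
  · omega
  · intro t ht
    rcases huniq t ht with rfl | rfl
    · rw [gu]; exact haK
    · rw [gx]; exact hbK
  · intro t ht t' ht' hne
    rcases huniq t ht with rfl | rfl <;> rcases huniq t' ht' with rfl | rfl
    · exact absurd rfl hne
    · rw [gu, gx]; exact fun e => hbF.1 e.symm
    · rw [gu, gx]; exact hbF.1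
    · exact absurd rfl hne
  · intro t ht t' ht' y hy hadj
    have hm := mem_eCol (c := c) hy hadj
    rcases huniq t ht with rfl | rfl <;> rcases huniq t' ht' with rfl | rfl
    · rw [gu]; rintro rfl; exact pe haF.1 hm
    · rw [gu]; rintro rfl; exact haF.2 hm
    · rw [gx]; rintro rfl; exact hbF.2.2 hm
    · rw [gx]; rintro rfl; exact pe hbF.2.1 hm
  · intro t ht y hy hadj z hz hyz hD
    have hm := mem_pCol (c := c) hy hadj hz hyz hD
    rcases huniq t ht with rfl | rfl
    · rw [gu]; rintro rfl; exact haF.1 hm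
    · rw [gx]; rintro rfl; exact hbF.2.1 hm

lemma sum_nb [Fintype V] (G : SimpleGraph V) (S : Finset V) :
    ∑ v ∈ S, (nb G S v).card =
      2 * {e ∈ G.edgeSet | ∀ v ∈ e, v ∈ (S : Set V)}.ncard := by
  let H : SimpleGraph V :=
    { Adj := fun a b => G.Adj a b ∧ a ∈ S ∧ b ∈ S
      symm := ⟨fun a b h => ⟨h.1.symm, h.2.2, h.2.1⟩⟩
      loopless := ⟨fun a h => G.irrefl h.1⟩ }
  have h1 : {e ∈ G.edgeSet | ∀ v ∈ e, v ∈ (S : Set V)} = (H.edgeFinset : Set (Sym2 V)) := by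
    ext e
    induction e using Sym2.ind with
    | _ a b => simp [H]
  have h2 := H.sum_degrees_eq_twice_card_edges
  rw [h1, Set.ncard_coe_finset, ← h2]
  rw [← Finset.sum_subset (Finset.subset_univ S)]
  · refine Finset.sum_congr rfl fun v hv => ?_
    rw [← SimpleGraph.card_neighborFinset_eq_degree]
    congr 1
    ext w
    simp only [mem_nb, SimpleGraph.mem_neighborFinset, H]
    tauto
  · intro v _ hv
    rw [← SimpleGraph.card_neighborFinset_eq_degree, Finset.card_eq_zero]
    ext w
    simp [H, hv]

/-- The discharging argument. -/
lemma exists_config [Fintype V] (G : SimpleGraph V) (hmad : MadLT G (14 / 5)) (S : Finset V)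
    (hS : S.Nonempty) :
    ∃ v ∈ S, (nb G S v).card ≤ 1 ∨ ((nb G S v).card = 2 ∧ ∃ x ∈ nb G S v,
      ((nb G S x).card ≤ 3 ∨ ((nb G S x).card = 4 ∧
        ∀ y ∈ nb G S x, (nb G S y).card ≤ 2))) := by
  by_contra! hc
  have key : ∀ v ∈ S, 14 + 2 * ((nb G S v).filter (fun w => (nb G S w).card = 2)).card
      ≤ 5 * (nb G S v).card + if (nb G S v).card = 2 then 4 else 0 := by
    intro v hv
    obtain ⟨hv1, hv2⟩ := hc v hv
    have hle := Finset.card_filter_le (nb G S v) (fun w => (nb G S w).card = 2)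
    -- a degree two neighbour forces degree at least four
    have h4 : 0 < ((nb G S v).filter (fun w => (nb G S w).card = 2)).card →
        3 < (nb G S v).card := by
      intro hp
      obtain ⟨w, hw⟩ := Finset.card_pos.1 hp
      rw [Finset.mem_filter, mem_nb] at hw
      exact ((hc w hw.1.1).2 hw.2 v (mem_nb.2 ⟨hv, hw.1.2.symm⟩)).1
    have h5 : (nb G S v).card = 4 →
        ((nb G S v).filter (fun w => (nb G S w).card = 2)).card < 4 := by
      intro hv4
      by_contra hcon
      have heq : (nb G S v).filter (fun w => (nb G S w).card = 2) = nb G S v :=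
        Finset.eq_of_subset_of_card_le (Finset.filter_subset _ _) (by omega)
      obtain ⟨w, hw⟩ := Finset.card_pos.1 (by omega : 0 < (nb G S v).card)
      have hw2 := hw
      rw [← heq, Finset.mem_filter] at hw2
      obtain ⟨y, hy, hy2⟩ :=
        ((hc w (mem_nb.1 hw).1).2 hw2.2 v (mem_nb.2 ⟨hv, (mem_nb.1 hw).2.symm⟩)).2 hv4
      rw [← heq, Finset.mem_filter] at hy
      omega
    split_ifs with h2 <;> omega
  have hsum := Finset.sum_le_sum key
  rw [Finset.sum_add_distrib, Finset.sum_add_distrib, ← Finset.mul_sum, ← Finset.mul_sum] at hsum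
  have hdc : ∑ v ∈ S, ((nb G S v).filter (fun w => (nb G S w).card = 2)).card
      = ∑ v ∈ S, if (nb G S v).card = 2 then 2 else 0 := by
    have e1 : ∀ v ∈ S, ((nb G S v).filter (fun w => (nb G S w).card = 2)).card
        = ∑ w ∈ S, if G.Adj v w ∧ (nb G S w).card = 2 then 1 else 0 := by
      intro v _
      rw [← Finset.card_filter, nb, Finset.filter_filter]
    rw [Finset.sum_congr rfl e1, Finset.sum_comm]
    refine Finset.sum_congr rfl fun w _ => ?_
    rw [← Finset.card_filter]
    split_ifs with h2
    · rw [← h2]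
      unfold nb
      congr 1
      ext z
      simp only [Finset.mem_filter]
      constructor
      · rintro ⟨a, b, -⟩; exact ⟨a, b.symm⟩
      · rintro ⟨a, b⟩; exact ⟨a, b.symm, by first | exact h2 | trivial⟩
    · simp [h2]
  have hdc2 : ∑ v ∈ S, (if (nb G S v).card = 2 then 4 else 0)
      = 2 * ∑ v ∈ S, if (nb G S v).card = 2 then 2 else 0 := by
    rw [Finset.mul_sum]
    refine Finset.sum_congr rfl fun w _ => ?_
    split_ifs <;> rfl
  rw [hdc, hdc2, sum_nb, Finset.sum_const, smul_eq_mul] at hsum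
  have hm := hmad (S : Set V) S.finite_toSet (by simpa using hS)
  rw [Set.ncard_coe_finset] at hm
  have hsum' : S.card * 14 ≤
      5 * (2 * {e ∈ G.edgeSet | ∀ v ∈ e, v ∈ (S : Set V)}.ncard) := by omega
  have : (S.card : ℚ) * 14 ≤
      5 * (2 * ({e ∈ G.edgeSet | ∀ v ∈ e, v ∈ (S : Set V)}.ncard : ℚ)) := by
    exact_mod_cast hsum'
  linarith

lemma exists_good [Fintype V] (G : SimpleGraph V) (Δ : ℕ) (hΔ : 2 ≤ Δ)
    (hub : ∀ v, natDeg G v ≤ Δ) (hmad : MadLT G (14 / 5)) (n : ℕ) :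
    ∀ S : Finset V, S.card = n → ∃ c D, Good G (2 * Δ + 4) S c D := by
  have hub' : ∀ (S : Finset V) (v : V), (nb G S v).card ≤ Δ := by
    intro S v
    refine le_trans ?_ (hub v)
    unfold natDeg
    rw [← Set.ncard_coe_finset]
    refine Set.ncard_le_ncard ?_ (Set.toFinite _)
    intro w hw
    exact (mem_nb.1 (Finset.mem_coe.1 hw)).2
  induction n with
  | zero =>
    intro S hS
    rw [Finset.card_eq_zero] at hS
    subst hS
    exact ⟨fun _ => 0, fun _ _ => True, by constructor <;> simp⟩
  | succ n ih =>
    intro S hS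
    obtain ⟨v, hv, hcfg⟩ := exists_config G hmad S (Finset.card_pos.1 (by omega))
    obtain ⟨c, D, hg⟩ := ih (S.erase v) (by rw [Finset.card_erase_of_mem hv]; omega)
    have hins : insert v (S.erase v) = S := Finset.insert_erase hv
    have hself : nb G (S.erase v) v = nb G S v := by
      rw [← nb_insert_self, hins]
    rw [← hins]
    rcases hcfg with h1 | ⟨h2, x, hx, h3⟩
    · exact step_leaf hg (Finset.notMem_erase v S) (hub' _) (by rw [hself]; exact h1)
    · exact step_two hΔ hg (Finset.notMem_erase v S) (hub' _) (by rw [hself]; exact h2)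
        (by rw [hself]; exact hx) (by rw [hins]; exact h3)

end Helpers

/-- If `G` has maximum degree `Δ ≥ 2` and maximum average degree `< 14/5`, then
`χ'_ss(G) ≤ 2Δ + 4`. -/
theorem ssIndex_le_of_mad_lt_fourteen_fifths {V : Type*} [Fintype V] (G : SimpleGraph V)
    (Δ : ℕ) (hΔ : 2 ≤ Δ) (hub : ∀ v, natDeg G v ≤ Δ) (hex : ∃ v, natDeg G v = Δ)
    (hmad : MadLT G (14 / 5)) :
    ssIndex G ≤ 2 * Δ + 4 := by
  classical
  obtain ⟨c, D, h⟩ := exists_good G Δ hΔ hub hmad _ Finset.univ rfl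
  refine Nat.sInf_le ⟨c, ?_, ?_⟩
  · intro e
    induction e using Sym2.ind with
    | _ a b => exact fun hab => h.lt a (Finset.mem_univ _) b (Finset.mem_univ _) hab
  · intro i
    have hP : ∀ a b, G.Adj a b → c s(a, b) = i → D a b →
        PendantIn G {e | e ∈ G.edgeSet ∧ c e = i} a := by
      intro a b hab hc hD
      refine ⟨⟨s(a, b), ⟨hab, hc⟩, Sym2.mem_mk_left a b⟩, b,
        ⟨⟨s(a, b), ⟨hab, hc⟩, Sym2.mem_mk_right a b⟩, hab⟩, ?_⟩
      rintro y ⟨⟨e, ⟨heG, hec⟩, hye⟩, hay⟩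
      by_contra hne
      obtain ⟨z, rfl⟩ := hye
      exact h.pend a (Finset.mem_univ _) b (Finset.mem_univ _) hab hD y (Finset.mem_univ _) hay
        hne z (Finset.mem_univ _) heG (hec.trans hc.symm)
    refine ⟨⟨fun e he => he.1, ?_⟩, ?_⟩
    · rintro e ⟨heG, hec⟩ f ⟨hfG, hfc⟩ hne v hve hvf
      obtain ⟨a, rfl⟩ := hve
      obtain ⟨b, rfl⟩ := hvf
      refine h.proper v (Finset.mem_univ _) a (Finset.mem_univ _) b (Finset.mem_univ _) heG hfG
        ?_ (hec.trans hfc.symm)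
      rintro rfl
      exact hne rfl
    · intro e
      induction e using Sym2.ind with
      | _ a b =>
        rintro ⟨hab, hc⟩
        rcases h.tot a (Finset.mem_univ _) b (Finset.mem_univ _) hab with hD | hD
        · exact ⟨a, Sym2.mem_mk_left a b, hP a b hab hc hD⟩
        · exact ⟨b, Sym2.mem_mk_right a b,
            hP b a (SimpleGraph.Adj.symm hab) (by rw [Sym2.eq_swap]; exact hc) hD⟩

end SSE
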